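/- arXiv:2308.16858 — 3 statements merged into one kernel-verified Lean document; each statement's English description precedes it below -/
import Mathlib

section
/- Half-quadratic scalar majorization for the hyperbolic potential: for every λ ≥ 0, δ > 0, and all u, v ∈ ℝ, λ√(u² + δ²) ≤ λ√(v² + δ²) + (λv/√(v² + δ²))·(u − v) + (1/2)·(λ/√(v² + δ²))·(u − v)². -/
/-- Half-quadratic scalar majorization for the hyperbolic potential. -/
theorem hyperbolic_half_quadratic_majorant (lam δ : ℝ) (hlam : 0 ≤ lam) (hδ : 0 < δ) :
    ∀ u v : ℝ, lam * Real.sqrt (u ^ 2 + δ ^ 2) ≤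
      lam * Real.sqrt (v ^ 2 + δ ^ 2) +
        (lam * v / Real.sqrt (v ^ 2 + δ ^ 2)) * (u - v) +
        (1 / 2) * (lam / Real.sqrt (v ^ 2 + δ ^ 2)) * (u - v) ^ 2 := by
  intro u v
  have hs : 0 < Real.sqrt (v ^ 2 + δ ^ 2) := Real.sqrt_pos.2 (by positivity)
  have hs2 : Real.sqrt (v ^ 2 + δ ^ 2) ^ 2 = v ^ 2 + δ ^ 2 := Real.sq_sqrt (by positivity)
  have ht2 : Real.sqrt (u ^ 2 + δ ^ 2) ^ 2 = u ^ 2 + δ ^ 2 := Real.sq_sqrt (by positivity)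
  set s := Real.sqrt (v ^ 2 + δ ^ 2)
  set t := Real.sqrt (u ^ 2 + δ ^ 2)
  have gap_eq : lam * s + (lam * v / s) * (u - v) + (1 / 2) * (lam / s) * (u - v) ^ 2 - lam * t =
      lam / (2 * s) * (s - t) ^ 2 := by
    field_simp
    linear_combination lam * hs2 - lam * ht2
  have gap_nonneg : 0 ≤ lam / (2 * s) * (s - t) ^ 2 := by positivity
  linarith
end

section
/- Half-quadratic scalar majorization for the Welsh potential: for every λ ≥ 0, δ > 0, and all u, v ∈ ℝ, λ(1 − exp(−u²/(2δ²))) ≤ λ(1 − exp(−v²/(2δ²))) + (λ/δ²)·v·exp(−v²/(2δ²))·(u − v) + (1/2)·(λ/δ²)·exp(−v²/(2δ²))·(u − v)². -/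
/-- The tangent line inequality for the exponential. -/
theorem exp_mul_one_add_sub_le_exp (a b : ℝ) :
    Real.exp b * (1 + (a - b)) ≤ Real.exp a := by
  calc Real.exp b * (1 + (a - b)) ≤ Real.exp b * Real.exp (a - b) := by
        gcongr
        linarith [Real.add_one_le_exp (a - b)]
    _ = Real.exp a := by rw [← Real.exp_add, add_sub_cancel]

/-- Half-quadratic scalar majorization for the Welsh potential. -/
theorem welsh_half_quadratic_majorant (lam δ : ℝ) (hlam : 0 ≤ lam) (hδ : 0 < δ) :
    ∀ u v : ℝ, lam * (1 - Real.exp (-u ^ 2 / (2 * δ ^ 2))) ≤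
      lam * (1 - Real.exp (-v ^ 2 / (2 * δ ^ 2))) +
        (lam / δ ^ 2) * v * Real.exp (-v ^ 2 / (2 * δ ^ 2)) * (u - v) +
        (1 / 2) * (lam / δ ^ 2) * Real.exp (-v ^ 2 / (2 * δ ^ 2)) * (u - v) ^ 2 := by
  intro u v
  have h := mul_le_mul_of_nonneg_left
    (exp_mul_one_add_sub_le_exp (-u ^ 2 / (2 * δ ^ 2)) (-v ^ 2 / (2 * δ ^ 2))) hlam
  generalize Real.exp (-u ^ 2 / (2 * δ ^ 2)) = x at h ⊢
  generalize Real.exp (-v ^ 2 / (2 * δ ^ 2)) = y at h ⊢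
  have key : (lam / δ ^ 2) * v * y * (u - v) + (1 / 2) * (lam / δ ^ 2) * y * (u - v) ^ 2 =
      lam * y - lam * (y * (1 + (-u ^ 2 / (2 * δ ^ 2) - -v ^ 2 / (2 * δ ^ 2)))) := by
    field_simp
    ring
  linarith
end

section
/- (Proposition 2, Welsh potential.) Let K, N be positive integers, L ∈ ℝ^{K×(N+1)}, η ≥ 0, ε > 0, λ ≥ 0, δ > 0, and take φ(w) = λ(1 − exp(−w²/(2δ²))) with ψ(w) = (λ/δ²)·exp(−w²/(2δ²)). Define A(θ') = 2LᵀL + Diag(ψ(θ'_1) + η, …, ψ(θ'_N) + η, ε) ∈ ℝ^{(N+1)×(N+1)}. Then for all θ, θ' ∈ ℝ^{N+1}: Φ(θ) ≤ Φ(θ') + ⟨∇Φ(θ'), θ − θ'⟩ + (1/2)·(θ − θ')ᵀ A(θ') (θ − θ'), with equality when θ = θ'. -/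
open scoped RealInnerProductSpace Matrix

/-- The squared hinge loss lies above its tangents and below the tangent parabolas of curvature
`2`. -/
lemma sq_hinge_taylor_bounds (a b : ℝ) :
    0 ≤ (max (1 - b) 0) ^ 2 - (max (1 - a) 0) ^ 2 - (b - a) * (-2 * max (1 - a) 0) ∧
      (max (1 - b) 0) ^ 2 - (max (1 - a) 0) ^ 2 - (b - a) * (-2 * max (1 - a) 0)
        ≤ (b - a) ^ 2 := by
  rcases max_cases (1 - a) 0 with ⟨h1, h2⟩ | ⟨h1, h2⟩ <;>
    rcases max_cases (1 - b) 0 with ⟨h3, h4⟩ | ⟨h3, h4⟩ <;>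
    rw [h1, h3] <;> constructor <;> nlinarith [sq_nonneg (b - a), sq_nonneg (1 - b)]

lemma hasDerivAt_sq_hinge (a : ℝ) :
    HasDerivAt (fun x : ℝ => (max (1 - x) 0) ^ 2) (-2 * max (1 - a) 0) a := by
  rw [hasDerivAt_iff_isLittleO]
  refine Asymptotics.IsBigO.trans_isLittleO ?_
    (Asymptotics.isLittleO_pow_sub_sub a (m := 2) one_lt_two)
  refine Asymptotics.IsBigO.of_bound 1 (Filter.Eventually.of_forall fun x => ?_)
  obtain ⟨h1, h2⟩ := sq_hinge_taylor_bounds a x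
  rw [smul_eq_mul, Real.norm_of_nonneg h1, one_mul, Real.norm_of_nonneg (by positivity),
    Real.norm_eq_abs, sq_abs]
  exact h2

lemma hasDerivAt_welsh (lam : ℝ) {δ : ℝ} (hδ : 0 < δ) (a : ℝ) :
    HasDerivAt (fun w : ℝ => lam * (1 - Real.exp (-w ^ 2 / (2 * δ ^ 2))))
      (a * (lam / δ ^ 2 * Real.exp (-a ^ 2 / (2 * δ ^ 2)))) a := by
  have h := ((((hasDerivAt_pow 2 a).neg.div_const (2 * δ ^ 2)).exp).const_sub 1).const_mul lam
  refine h.congr_deriv ?_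
  simp only [Pi.neg_apply]
  field_simp
  norm_num
  ring

/-- The half-quadratic parabola of the Welsh potential is a majorant. -/
lemma welsh_le_tangent_parabola {lam δ : ℝ} (hlam : 0 ≤ lam) (hδ : 0 < δ) (a b : ℝ) :
    lam * (1 - Real.exp (-b ^ 2 / (2 * δ ^ 2))) ≤
      lam * (1 - Real.exp (-a ^ 2 / (2 * δ ^ 2)))
        + a * (lam / δ ^ 2 * Real.exp (-a ^ 2 / (2 * δ ^ 2))) * (b - a)
        + 1 / 2 * (lam / δ ^ 2 * Real.exp (-a ^ 2 / (2 * δ ^ 2))) * (b - a) ^ 2 := by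
  have h1 := Real.add_one_le_exp (-b ^ 2 / (2 * δ ^ 2) - -a ^ 2 / (2 * δ ^ 2))
  have h2 : Real.exp (-b ^ 2 / (2 * δ ^ 2)) = Real.exp (-a ^ 2 / (2 * δ ^ 2)) *
      Real.exp (-b ^ 2 / (2 * δ ^ 2) - -a ^ 2 / (2 * δ ^ 2)) := by
    rw [← Real.exp_add]; congr 1; ring
  have h3 := mul_le_mul_of_nonneg_left h1
    (mul_nonneg hlam (Real.exp_pos (-a ^ 2 / (2 * δ ^ 2))).le)
  rw [h2]
  generalize Real.exp (-a ^ 2 / (2 * δ ^ 2)) = E at *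
  have h4 : lam * E * (-b ^ 2 / (2 * δ ^ 2) - -a ^ 2 / (2 * δ ^ 2) + 1) = lam * E -
      a * (lam / δ ^ 2 * E) * (b - a) - 1 / 2 * (lam / δ ^ 2 * E) * (b - a) ^ 2 := by
    field_simp
    ring
  linarith

lemma inner_gradient_eq_of_hasFDerivAt {E : Type*} [NormedAddCommGroup E] [InnerProductSpace ℝ E]
    [CompleteSpace E] {f : E → ℝ} {f' : E →L[ℝ] ℝ} {x : E} (h : HasFDerivAt f f' x) (v : E) :
    ⟪gradient f x, v⟫ = f' v := by
  rw [gradient, InnerProductSpace.toDual_symm_apply, h.fderiv]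

lemma dotProduct_mulVec_gram_add_diagonal {K N : ℕ} (L : Matrix (Fin K) (Fin (N + 1)) ℝ)
    (d : ℝ → ℝ) (ε : ℝ) (u v : Fin (N + 1) → ℝ) :
    v ⬝ᵥ ((2 : ℝ) • (Lᵀ * L) + Matrix.diagonal (fun i : Fin (N + 1) =>
        if (i : ℕ) < N then d (u i) else ε)).mulVec v =
      2 * ∑ k, (L.mulVec v k) ^ 2 +
        (∑ i : Fin N, d (u i.castSucc) * v i.castSucc ^ 2 + ε * v (Fin.last N) ^ 2) := by
  rw [Matrix.add_mulVec, dotProduct_add, Matrix.smul_mulVec, dotProduct_smul,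
    ← Matrix.mulVec_mulVec, Matrix.dotProduct_mulVec, Matrix.vecMul_transpose, smul_eq_mul]
  congr 1
  · simp only [dotProduct, sq]
  · simp only [dotProduct, Matrix.mulVec_diagonal, Fin.sum_univ_castSucc, Fin.val_castSucc,
      Fin.is_lt, if_true, Fin.val_last, lt_irrefl, if_false]
    congr 1
    · exact Finset.sum_congr rfl fun i _ => by ring
    · ring

/-- The `k`-th coordinate of `θ ↦ Lθ` as a continuous linear functional. -/
noncomputable def mulVecCoord {m n : ℕ} (L : Matrix (Fin m) (Fin n) ℝ) (k : Fin m) :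
    EuclideanSpace ℝ (Fin n) →L[ℝ] ℝ :=
  ∑ j, L k j • EuclideanSpace.proj j

lemma mulVecCoord_apply {m n : ℕ} (L : Matrix (Fin m) (Fin n) ℝ) (k : Fin m)
    (θ : EuclideanSpace ℝ (Fin n)) : mulVecCoord L k θ = L.mulVec θ k := by
  simp [mulVecCoord, Matrix.mulVec, dotProduct]

/-- Directional derivatives of the SVM objective. -/
lemma inner_gradient_svm_objective {K N : ℕ} (L : Matrix (Fin K) (Fin (N + 1)) ℝ) (η : ℝ)
    {φ φ' : ℝ → ℝ} (hφ : ∀ w, HasDerivAt φ (φ' w) w) (x v : EuclideanSpace ℝ (Fin (N + 1))) :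
    ⟪gradient (fun θ : EuclideanSpace ℝ (Fin (N + 1)) =>
        ∑ k : Fin K, (max (1 - L.mulVec θ k) 0) ^ 2 +
          (∑ i : Fin N, φ (θ i.castSucc) + η / 2 * ∑ i : Fin N, θ i.castSucc ^ 2)) x, v⟫ =
      ∑ k : Fin K, -2 * max (1 - L.mulVec x k) 0 * L.mulVec v k +
        (∑ i : Fin N, φ' (x i.castSucc) * v i.castSucc +
          η * ∑ i : Fin N, x i.castSucc * v i.castSucc) := by
  have h1 (k : Fin K) := (hasDerivAt_sq_hinge (mulVecCoord L k x)).comp_hasFDerivAt x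
    (mulVecCoord L k).hasFDerivAt
  have hp (i : Fin N) := (EuclideanSpace.proj i.castSucc :
    EuclideanSpace ℝ (Fin (N + 1)) →L[ℝ] ℝ).hasFDerivAt (x := x)
  have h2 (i : Fin N) := (hφ (x i.castSucc)).comp_hasFDerivAt x (hp i)
  have h3 (i : Fin N) := (hasDerivAt_pow 2 (x i.castSucc)).comp_hasFDerivAt x (hp i)
  have h := (HasFDerivAt.fun_sum fun k (_ : k ∈ Finset.univ) => h1 k).add
    ((HasFDerivAt.fun_sum fun i (_ : i ∈ Finset.univ) => h2 i).add
      ((HasFDerivAt.fun_sum fun i (_ : i ∈ Finset.univ) => h3 i).const_mul (η / 2)))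
  have h' := inner_gradient_eq_of_hasFDerivAt h v
  simp only [← mulVecCoord_apply]
  refine h'.trans ?_
  simp [Finset.mul_sum]
  refine Finset.sum_congr rfl fun i _ => by ring

/-- (Proposition 2, Welsh potential.) The half-quadratic construction
`h(θ; θ') = Φ(θ') + ⟪∇Φ(θ'), θ − θ'⟫ + ½ (θ − θ')ᵀ A(θ') (θ − θ')`, with
`A(θ') = 2LᵀL + Diag(ψ(θ'₁) + η, …, ψ(θ'_N) + η, ε)` and
`ψ(w) = (λ/δ²) exp(−w²/(2δ²))`, is a tangent majorant of the SVM objective `Φ`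
at every `θ'`. -/
theorem svm_half_quadratic_majorant_welsh
    (K N : ℕ) (hK : 0 < K) (hN : 0 < N) (L : Matrix (Fin K) (Fin (N + 1)) ℝ)
    (η ε lam δ : ℝ) (hη : 0 ≤ η) (hε : 0 < ε) (hlam : 0 ≤ lam) (hδ : 0 < δ)
    (φ ψ : ℝ → ℝ)
    (hφ : ∀ w, φ w = lam * (1 - Real.exp (-w ^ 2 / (2 * δ ^ 2))))
    (hψ : ∀ w, ψ w = (lam / δ ^ 2) * Real.exp (-w ^ 2 / (2 * δ ^ 2)))
    (Φ : EuclideanSpace ℝ (Fin (N + 1)) → ℝ)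
    (hΦ : ∀ θ, Φ θ = ∑ k : Fin K, (max (1 - L.mulVec θ k) 0) ^ 2 +
      (∑ i : Fin N, φ (θ i.castSucc) + η / 2 * ∑ i : Fin N, θ i.castSucc ^ 2))
    (A : EuclideanSpace ℝ (Fin (N + 1)) → Matrix (Fin (N + 1)) (Fin (N + 1)) ℝ)
    (hA : ∀ θ', A θ' = (2 : ℝ) • (Lᵀ * L) +
      Matrix.diagonal (fun i : Fin (N + 1) =>
        if (i : ℕ) < N then ψ (θ' i) + η else ε)) :
    ∀ θ θ' : EuclideanSpace ℝ (Fin (N + 1)),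
      (Φ θ ≤ Φ θ' + ⟪gradient Φ θ', θ - θ'⟫ +
        1 / 2 * ((θ - θ') ⬝ᵥ (A θ').mulVec (θ - θ'))) ∧
      (θ = θ' → Φ θ' + ⟪gradient Φ θ', θ - θ'⟫ +
        1 / 2 * ((θ - θ') ⬝ᵥ (A θ').mulVec (θ - θ')) = Φ θ) := by
  intro θ θ'
  refine ⟨?_, fun h => by subst h; simp⟩
  obtain rfl : Φ = _ := funext hΦ
  have hd (w : ℝ) : HasDerivAt φ (w * ψ w) w := by
    rw [funext hφ, hψ]
    exact hasDerivAt_welsh lam hδ w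
  rw [inner_gradient_svm_objective L η hd, hA, WithLp.ofLp_sub,
    dotProduct_mulVec_gram_add_diagonal L (fun w => ψ w + η) ε θ']
  have e1 := Finset.sum_le_sum fun k (_ : k ∈ Finset.univ) =>
    (sq_hinge_taylor_bounds (L.mulVec θ' k) (L.mulVec θ k)).2
  have e2 : ∑ i : Fin N, φ (θ i.castSucc) ≤ ∑ i : Fin N, (φ (θ' i.castSucc)
      + θ' i.castSucc * ψ (θ' i.castSucc) * (θ i.castSucc - θ' i.castSucc)
      + 1 / 2 * ψ (θ' i.castSucc) * (θ i.castSucc - θ' i.castSucc) ^ 2) :=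
    Finset.sum_le_sum fun i _ => by
      simp only [hφ, hψ]
      exact welsh_le_tangent_parabola hlam hδ _ _
  have e3 : η / 2 * ∑ i : Fin N, θ i.castSucc ^ 2 = η / 2 * ∑ i : Fin N, θ' i.castSucc ^ 2
      + η * ∑ i : Fin N, θ' i.castSucc * (θ i.castSucc - θ' i.castSucc)
      + 1 / 2 * ∑ i : Fin N, η * (θ i.castSucc - θ' i.castSucc) ^ 2 := by
    simp only [Finset.mul_sum, ← Finset.sum_add_distrib]
    exact Finset.sum_congr rfl fun i _ => by ring
  have e4 : 0 ≤ ε * (θ (Fin.last N) - θ' (Fin.last N)) ^ 2 := by positivity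
  have e5 (k : Fin K) : L.mulVec (θ.ofLp - θ'.ofLp) k = L.mulVec θ k - L.mulVec θ' k := by
    simp [Matrix.mulVec_sub]
  have e6 : ∑ k : Fin K, -2 * max (1 - L.mulVec θ' k) 0 * (L.mulVec θ k - L.mulVec θ' k) =
      ∑ k : Fin K, (L.mulVec θ k - L.mulVec θ' k) * (-2 * max (1 - L.mulVec θ' k) 0) :=
    Finset.sum_congr rfl fun k _ => mul_comm _ _
  have e7 : ∑ i : Fin N, 1 / 2 * ψ (θ' i.castSucc) * (θ i.castSucc - θ' i.castSucc) ^ 2 =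
      1 / 2 * ∑ i : Fin N, ψ (θ' i.castSucc) * (θ i.castSucc - θ' i.castSucc) ^ 2 := by
    rw [Finset.mul_sum]
    exact Finset.sum_congr rfl fun i _ => by ring
  simp only [Finset.sum_sub_distrib] at e1
  simp only [Finset.sum_add_distrib, e7] at e2
  simp only [e5, e6, Pi.sub_apply, add_mul, Finset.sum_add_distrib]
  linarith
end
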